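/- arXiv:1907.02893 — 5 statements merged into one kernel-verified Lean document; each statement's English description precedes it below -/
import Mathlib

section
/- Let E be a finite index set and for each e ∈ E let R^e : ℝ^d → ℝ be convex and differentiable. Let Φ ∈ ℝ^{p×d} and w ∈ ℝ^p be such that w simultaneously minimizes w̄ ↦ R^e(Φᵀ w̄) over ℝ^p for every e ∈ E, and set v = Φᵀ w ∈ ℝ^d. Then vᵀ ∇R^e(v) = 0 for all e ∈ E. (Forward direction of Theorem 4 of the paper.) -/
open Matrix

/-- Forward direction of Theorem 4 (IRM paper): if `w ∈ ℝ^p` simultaneously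
minimizes `w̄ ↦ R^e(Φᵀ w̄)` for every environment `e`, where each `R^e : ℝ^d → ℝ`
is convex and differentiable, then the predictor `v = Φᵀ w` satisfies the
orthogonality condition `vᵀ ∇R^e(v) = 0` for every `e`. The gradient is
expressed coordinatewise via the Fréchet derivative along basis directions. -/
theorem simultaneous_optimum_implies_orthogonality
    {d p : ℕ} {E : Type*} [Fintype E]
    (R : E → (Fin d → ℝ) → ℝ)
    (hconv : ∀ e, ConvexOn ℝ Set.univ (R e))
    (hdiff : ∀ e, Differentiable ℝ (R e))
    (Φ : Matrix (Fin p) (Fin d) ℝ) (w : Fin p → ℝ)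
    (hopt : ∀ e, ∀ w' : Fin p → ℝ, R e (Φᵀ.mulVec w) ≤ R e (Φᵀ.mulVec w'))
    (v : Fin d → ℝ) (hv : v = Φᵀ.mulVec w) :
    ∀ e, ∑ i, v i * fderiv ℝ (R e) v (Pi.single i 1) = 0 := by
  intro e
  have hsum : ∑ i, v i * fderiv ℝ (R e) v (Pi.single i 1) = fderiv ℝ (R e) v v := by
    have hbasis (i : Fin d) :
        (Pi.single i 1 : Fin d → ℝ) = fun j => if i = j then 1 else 0 := by
      ext j
      simp [Pi.single_apply, eq_comm]
    simpa [hbasis] using ((fderiv ℝ (R e) v).toLinearMap.pi_apply_eq_sum_univ v).symm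
  rw [hsum]
  have hmin : IsLocalMin (fun t : ℝ => R e (t • v)) 1 := by
    refine Filter.Eventually.of_forall fun t => ?_
    simpa [hv, Matrix.mulVec_smul] using hopt e (t • w)
  have hray : HasDerivAt (fun t : ℝ => t • v) v 1 := by
    simpa using (hasDerivAt_id (1 : ℝ)).smul_const v
  have hR : HasFDerivAt (R e) (fderiv ℝ (R e) v) ((1 : ℝ) • v) := by
    simpa using (hdiff e v).hasFDerivAt
  exact hmin.hasDerivAt_eq_zero (hR.comp_hasDerivAt 1 hray)
end

section
/- Let E be a finite index set and for each e ∈ E let R^e : ℝ^d → ℝ be convex and differentiable. If v ∈ ℝ^d satisfies vᵀ ∇R^e(v) = 0 for all e ∈ E, then there exist a natural number p, a matrix Φ ∈ ℝ^{p×d}, and a vector w ∈ ℝ^p such that v = Φᵀ w and w simultaneously minimizes w̄ ↦ R^e(Φᵀ w̄) over ℝ^p for every e ∈ E. (Converse direction of Theorem 4 of the paper.) -/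
open Matrix

/-- A convex function on `ℝ` with vanishing derivative at `x` attains its minimum at `x`. -/
theorem ConvexOn.le_of_hasDerivAt_zero {f : ℝ → ℝ} {x : ℝ} (hf : ConvexOn ℝ Set.univ f)
    (hx : HasDerivAt f 0 x) (y : ℝ) : f x ≤ f y := by
  rcases lt_trichotomy x y with h | rfl | h
  · have := hf.le_slope_of_hasDerivAt (Set.mem_univ _) (Set.mem_univ _) h hx
    rw [slope_def_field, le_div_iff₀ (sub_pos.2 h)] at this
    linarith
  · rfl
  · have := hf.slope_le_of_hasDerivAt (Set.mem_univ _) (Set.mem_univ _) h hx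
    rw [slope_def_field, div_le_iff₀ (sub_pos.2 h)] at this
    linarith

/-- If the derivative of a convex function at `v` vanishes in the direction `v`, then `v`
minimizes the function along the line `ℝ v`. -/
theorem ConvexOn.le_smul_of_fderiv_apply_self_eq_zero {V : Type*} [NormedAddCommGroup V]
    [NormedSpace ℝ V] {f : V → ℝ} {v : V} (hf : ConvexOn ℝ Set.univ f)
    (hd : DifferentiableAt ℝ f v) (hv : fderiv ℝ f v v = 0) (t : ℝ) : f v ≤ f (t • v) := by
  have hline : HasDerivAt (fun s : ℝ => s • v) v 1 := by
    simpa using (hasDerivAt_id (1 : ℝ)).smul_const v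
  have hderiv : HasDerivAt (fun s : ℝ => f (s • v)) 0 1 := by
    have hd' : HasFDerivAt f (fderiv ℝ f v) ((1 : ℝ) • v) := by
      simpa using hd.hasFDerivAt
    simpa [hv, Function.comp_def] using hd'.comp_hasDerivAt (1 : ℝ) hline
  have hconv : ConvexOn ℝ Set.univ (fun s : ℝ => f (s • v)) :=
    hf.comp_linearMap (LinearMap.toSpanSingleton ℝ V v)
  simpa using hconv.le_of_hasDerivAt_zero hderiv t

/-- Converse direction of Theorem 4 (IRM paper): if `v ∈ ℝ^d` satisfies the
orthogonality conditions `vᵀ ∇R^e(v) = 0` for all environments `e`, with each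
`R^e : ℝ^d → ℝ` convex and differentiable, then there exist `p`, a matrix
`Φ ∈ ℝ^{p×d}` and a vector `w ∈ ℝ^p` such that `v = Φᵀ w` and `w` simultaneously
minimizes `w̄ ↦ R^e(Φᵀ w̄)` over `ℝ^p` for every `e`. The gradient is expressed
coordinatewise via the Fréchet derivative along basis directions. -/
theorem orthogonality_implies_decomposition
    {d : ℕ} {E : Type*} [Fintype E]
    (R : E → (Fin d → ℝ) → ℝ)
    (hconv : ∀ e, ConvexOn ℝ Set.univ (R e))
    (hdiff : ∀ e, Differentiable ℝ (R e))
    (v : Fin d → ℝ)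
    (hv : ∀ e, ∑ i, v i * fderiv ℝ (R e) v (Pi.single i 1) = 0) :
    ∃ (p : ℕ) (Φ : Matrix (Fin p) (Fin d) ℝ) (w : Fin p → ℝ),
      v = Φᵀ.mulVec w ∧
        ∀ e, ∀ w' : Fin p → ℝ, R e (Φᵀ.mulVec w) ≤ R e (Φᵀ.mulVec w') := by
  have hΦ : ∀ w : Fin 1 → ℝ, (Matrix.of fun _ : Fin 1 => v)ᵀ.mulVec w = w 0 • v := by
    intro w
    ext i
    simp [Matrix.mulVec, dotProduct, mul_comm]
  refine ⟨1, Matrix.of fun _ => v, fun _ => 1, by simp [hΦ], fun e w' => ?_⟩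
  have hzero : fderiv ℝ (R e) v v = 0 := by
    rw [← hv e]
    conv_lhs => rw [← ContinuousLinearMap.coe_coe, LinearMap.pi_apply_eq_sum_univ]
    refine Finset.sum_congr rfl fun i _ => ?_
    rw [smul_eq_mul, ContinuousLinearMap.coe_coe]
    congr 2
    ext j
    simp [Pi.single_apply, eq_comm]
  simpa [hΦ] using
    (hconv e).le_smul_of_fderiv_apply_self_eq_zero (hdiff e v) hzero (w' 0)
end

section
/- Let E be a finite index set, for each e ∈ E let R^e : ℝ^d → ℝ be convex and differentiable, and let v ∈ ℝ^d satisfy vᵀ ∇R^e(v) = 0 for all e ∈ E. Then for a matrix Φ ∈ ℝ^{p×d} there exists w ∈ ℝ^p with v = Φᵀ w and w simultaneously minimizing w̄ ↦ R^e(Φᵀ w̄) for every e ∈ E, if and only if the nullspace Ker(Φ) is orthogonal to v and contains ∇R^e(v) for every e ∈ E. (Characterization of admissible representations in Theorem 4 of the paper.) -/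
open Matrix

/-- A linear form on `n → K` is the dot product with its values on the standard basis. -/
lemma LinearMap.apply_eq_dotProduct_single {n K : Type*} [Fintype n] [DecidableEq n] [Field K]
    (g : (n → K) →ₗ[K] K) (x : n → K) : g x = x ⬝ᵥ fun i => g (Pi.single i 1) := by
  conv_lhs => rw [pi_eq_sum_univ' x]
  simp [dotProduct]

/-- A vector orthogonal to the kernel of a matrix lies in its row space. -/
lemma Matrix.exists_transpose_mulVec_eq_of_forall_ker {m n K : Type*} [Fintype m] [Fintype n]
    [Field K] (A : Matrix m n K) (v : n → K) (h : ∀ x, A *ᵥ x = 0 → v ⬝ᵥ x = 0) :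
    ∃ w, Aᵀ *ᵥ w = v := by
  classical
  have hmem : Fintype.linearCombination K v ∈ LinearMap.range A.mulVecLin.dualMap := by
    rw [LinearMap.range_dualMap_eq_dualAnnihilator_ker, Submodule.mem_dualAnnihilator]
    intro x hx
    simpa [Fintype.linearCombination_apply, dotProduct, mul_comm] using h x (by simpa using hx)
  obtain ⟨g, hg⟩ := hmem
  refine ⟨fun i => g (Pi.single i 1), funext fun j => ?_⟩
  have hj : g (A.col j) = v j := by
    simpa [Fintype.linearCombination_apply_single] using
      LinearMap.congr_fun hg (Pi.single j 1)
  rw [← hj, g.apply_eq_dotProduct_single]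
  rfl

/-- A critical point of a convex function is a global minimizer. -/
lemma ConvexOn.isMinOn_of_hasFDerivAt_zero {F : Type*} [NormedAddCommGroup F] [NormedSpace ℝ F]
    {f : F → ℝ} (hf : ConvexOn ℝ Set.univ f) {a : F}
    (ha : HasFDerivAt f (0 : F →L[ℝ] ℝ) a) : IsMinOn f Set.univ a := by
  intro b _
  have hline : HasDerivAt (fun t : ℝ => f (AffineMap.lineMap a b t)) 0 0 := by
    have hab : HasFDerivAt f (0 : F →L[ℝ] ℝ) (AffineMap.lineMap a b (0 : ℝ)) := by simpa using ha
    exact hab.comp_hasDerivAt (0 : ℝ) AffineMap.hasDerivAt_lineMap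
  have hconv : ConvexOn ℝ Set.univ (fun t : ℝ => f (AffineMap.lineMap a b t)) :=
    hf.comp_affineMap (AffineMap.lineMap a b)
  have := hconv.le_slope_of_hasDerivAt (Set.mem_univ 0) (Set.mem_univ 1) one_pos hline
  simpa [slope_def_field] using this

/-- A linear form vanishes on the row space of `A` exactly when its coefficient vector lies in the
kernel of `A`. -/
lemma Matrix.comp_transpose_mulVecLin_eq_zero_iff {m n : Type*} [Fintype m] [Fintype n]
    [DecidableEq n] (A : Matrix m n ℝ) (L : (n → ℝ) →L[ℝ] ℝ) :
    L.comp Aᵀ.mulVecLin.toContinuousLinearMap = 0 ↔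
      A *ᵥ (fun i => L (Pi.single i 1)) = 0 := by
  have key (w : m → ℝ) : L (Aᵀ *ᵥ w) = w ⬝ᵥ A *ᵥ (fun i => L (Pi.single i 1)) := by
    rw [dotProduct_mulVec, ← mulVec_transpose]
    exact L.toLinearMap.apply_eq_dotProduct_single (Aᵀ *ᵥ w)
  constructor
  · intro h
    refine dotProduct_eq_zero _ fun w => ?_
    rw [dotProduct_comm, ← key]
    exact DFunLike.congr_fun h w
  · intro h
    ext1 w
    exact (key w).trans (by simp [h])

/-- Characterization of admissible representations in Theorem 4 (IRM paper):
assume `v ∈ ℝ^d` satisfies `vᵀ ∇R^e(v) = 0` for all environments `e`, with each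
`R^e : ℝ^d → ℝ` convex and differentiable. Then, for a matrix `Φ ∈ ℝ^{p×d}`,
there exists `w ∈ ℝ^p` with `v = Φᵀ w` and `w` simultaneously minimizing
`w̄ ↦ R^e(Φᵀ w̄)` for every `e`, if and only if the nullspace `Ker(Φ)` is
orthogonal to `v` and contains every gradient `∇R^e(v)`. The gradient is
expressed coordinatewise via the Fréchet derivative along basis directions. -/
theorem decomposition_iff_nullspace_conditions
    {d p : ℕ} {E : Type*} [Fintype E]
    (R : E → (Fin d → ℝ) → ℝ)
    (hconv : ∀ e, ConvexOn ℝ Set.univ (R e))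
    (hdiff : ∀ e, Differentiable ℝ (R e))
    (v : Fin d → ℝ)
    (hv : ∀ e, ∑ i, v i * fderiv ℝ (R e) v (Pi.single i 1) = 0)
    (Φ : Matrix (Fin p) (Fin d) ℝ) :
    (∃ w : Fin p → ℝ, v = Φᵀ.mulVec w ∧
        ∀ e, ∀ w' : Fin p → ℝ, R e (Φᵀ.mulVec w) ≤ R e (Φᵀ.mulVec w')) ↔
      ((∀ x : Fin d → ℝ, Φ.mulVec x = 0 → ∑ i, v i * x i = 0) ∧
        (∀ e, Φ.mulVec (fun i => fderiv ℝ (R e) v (Pi.single i 1)) = 0)) := by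
  have hderiv (e : E) (w : Fin p → ℝ) (hw : v = Φᵀ *ᵥ w) :
      HasFDerivAt (fun w' => R e (Φᵀ *ᵥ w'))
        ((fderiv ℝ (R e) v).comp Φᵀ.mulVecLin.toContinuousLinearMap) w := by
    subst hw
    exact (hdiff e _).hasFDerivAt.comp w Φᵀ.mulVecLin.toContinuousLinearMap.hasFDerivAt
  constructor
  · rintro ⟨w, hw, hmin⟩
    refine ⟨fun x hx => ?_, fun e => ?_⟩
    · change v ⬝ᵥ x = 0
      rw [hw, mulVec_transpose, ← dotProduct_mulVec, hx, dotProduct_zero]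
    · rw [← comp_transpose_mulVecLin_eq_zero_iff]
      have hlocal : IsLocalMin (fun w' => R e (Φᵀ *ᵥ w')) w :=
        Filter.Eventually.of_forall (hmin e)
      exact hlocal.hasFDerivAt_eq_zero (hderiv e w hw)
  · rintro ⟨horth, hgrad⟩
    obtain ⟨w, hw⟩ := Φ.exists_transpose_mulVec_eq_of_forall_ker v horth
    refine ⟨w, hw.symm, fun e w' => ?_⟩
    have hcrit := hderiv e w hw.symm
    rw [(comp_transpose_mulVecLin_eq_zero_iff Φ _).2 (hgrad e)] at hcrit
    have hconvw : ConvexOn ℝ Set.univ (fun w' => R e (Φᵀ *ᵥ w')) :=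
      (hconv e).comp_linearMap Φᵀ.mulVecLin
    exact hconvw.isMinOn_of_hasFDerivAt_zero hcrit (Set.mem_univ w')
end

section
/- Fix integers d ≥ 1 and r with 0 < r ≤ d, a finite index set E, symmetric positive semidefinite matrices Σ^e ∈ ℝ^{d×d} and vectors b^e ∈ ℝ^d for e ∈ E satisfying: for every nonzero x ∈ ℝ^d, the linear span of {Σ^e x − b^e : e ∈ E} has dimension strictly greater than d − r. Let Φ ∈ ℝ^{d×d} have rank r, and let w, u ∈ ℝ^d. If Φ(Σ^e(Φᵀ w − u) − b^e) = 0 for every e ∈ E, then Φᵀ w = u. (Algebraic core of Theorem 9 of the paper: general position forces the learned predictor to equal the invariant one.) -/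
open Matrix

/-- Algebraic core of Theorem 9 (IRM paper): suppose the symmetric positive
semidefinite matrices `Sig e` and the vectors `b e` are such that, for every
nonzero `x ∈ ℝ^d`, the span of `{Sig e *ᵥ x − b e : e ∈ E}` has dimension
strictly greater than `d − r`. If `Φ ∈ ℝ^{d×d}` has rank `r` and
`Φ *ᵥ (Sig e *ᵥ (Φᵀ w − u) − b e) = 0` for every environment `e`, then
`Φᵀ w = u`. -/
theorem general_position_forces_invariant_predictor
    {d : ℕ} (hd : 1 ≤ d) {E : Type*} [Fintype E]
    (r : ℕ) (hr : 0 < r) (hrd : r ≤ d)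
    (Sig : E → Matrix (Fin d) (Fin d) ℝ) (b : E → Fin d → ℝ)
    (hsymm : ∀ e, (Sig e).IsSymm) (hpsd : ∀ e, (Sig e).PosSemidef)
    (hgen : ∀ x : Fin d → ℝ, x ≠ 0 →
      d - r < Module.finrank ℝ
        (Submodule.span ℝ (Set.range fun e => (Sig e).mulVec x - b e)))
    (Φ : Matrix (Fin d) (Fin d) ℝ) (hrank : Φ.rank = r)
    (w u : Fin d → ℝ)
    (hcon : ∀ e, Φ.mulVec ((Sig e).mulVec (Φᵀ.mulVec w - u) - b e) = 0) :
    Φᵀ.mulVec w = u := by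
  by_contra hne
  have hlt := hgen _ (sub_ne_zero.mpr hne)
  have hle : Submodule.span ℝ
      (Set.range fun e => (Sig e).mulVec (Φᵀ.mulVec w - u) - b e) ≤
      LinearMap.ker Φ.mulVecLin := by
    rw [Submodule.span_le]
    rintro _ ⟨e, rfl⟩
    exact hcon e
  have hmono := Submodule.finrank_mono hle
  have hnullity := LinearMap.finrank_range_add_finrank_ker Φ.mulVecLin
  rw [Module.finrank_fin_fun] at hnullity
  have hrange : Module.finrank ℝ (LinearMap.range Φ.mulVecLin) = r := hrank
  omega
end

section
/- Fix integers d ≥ 1, m ≥ 1, a positive integer r ≤ d with m > d − r + d/r, and an arbitrary fixed tuple of vectors (b^e)_{e=1}^m with b^e ∈ ℝ^d. Consider the finite-dimensional real vector space of m-tuples of symmetric d×d real matrices, equipped with its Lebesgue (additive Haar) measure. Then the set of tuples (Σ^1, …, Σ^m) of symmetric matrices for which the linear general position condition of degree r fails — that is, for which there exists a nonzero x ∈ ℝ^d such that the span of {Σ^e x − b^e : e = 1, …, m} has dimension at most d − r — has measure zero. (Theorem 10 of the paper.) -/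
open Matrix MeasureTheory

/-- The range of a `C¹` map from a space of smaller dimension is Lebesgue-null. -/
theorem volume_range_eq_zero_of_finrank_lt {E κ : Type*} [NormedAddCommGroup E]
    [NormedSpace ℝ E] [FiniteDimensional ℝ E] [Fintype κ] {g : E → EuclideanSpace ℝ κ}
    (hg : ContDiff ℝ 1 g) (hcard : Module.finrank ℝ E < Fintype.card κ) :
    volume (Set.range g) = 0 := by
  have hdim : dimH (Set.range fun a => (g a).ofLp) < ((Fintype.card κ : NNReal) : ENNReal) := by
    have hc : ContDiff ℝ 1 fun a => (g a).ofLp := by fun_prop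
    refine hc.dimH_range_le.trans_lt ?_
    exact_mod_cast hcard
  have hnull := hausdorffMeasure_of_dimH_lt hdim
  rw [NNReal.coe_natCast, hausdorffMeasure_pi_real] at hnull
  refine measure_mono_null ?_ ((PiLp.volume_preserving_ofLp κ).quasiMeasurePreserving.preimage_null
    hnull)
  rintro _ ⟨a, rfl⟩
  exact ⟨a, rfl⟩

/-- From any family of vectors one can select at most `finrank` many members having the same
span. -/
theorem exists_finset_card_le_finrank_span {ι V : Type*} [Fintype ι]
    [AddCommGroup V] [Module ℝ V] (v : ι → V) :
    ∃ J : Finset ι, J.card ≤ Module.finrank ℝ (Submodule.span ℝ (Set.range v)) ∧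
      ∀ e, v e ∈ Submodule.span ℝ (v '' J) := by
  classical
  obtain ⟨κ, a, ha, hspan, hli⟩ := exists_linearIndependent' ℝ v
  have : Fintype κ := Fintype.ofInjective a ha
  refine ⟨Finset.univ.image a, ?_, fun e => ?_⟩
  · rw [Finset.card_image_of_injective _ ha, ← hspan, finrank_span_eq_card hli, Finset.card_univ]
  · rw [Finset.coe_image, Finset.coe_univ, Set.image_univ, ← Set.range_comp, hspan]
    exact Submodule.subset_span ⟨e, rfl⟩

theorem card_sym2_mem {n : Type*} [Fintype n] [DecidableEq n] (p : n) :
    (Finset.univ.filter fun s : Sym2 n => p ∈ s).card = Fintype.card n := by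
  have : (Finset.univ.filter fun s : Sym2 n => p ∈ s) = Finset.univ.image fun i => s(p, i) := by
    ext s
    simp [Sym2.mem_iff_exists, eq_comm]
  rw [this, Finset.card_image_of_injective _ fun i j h => Sym2.congr_right.1 h, Finset.card_univ]

section Parametrization

variable {ι n : Type*} [Fintype ι] [DecidableEq ι] [Fintype n] [DecidableEq n]

/-- Coordinates of a tuple of symmetric matrices that are left free once the matrices outside `J`
are required to have a prescribed product with a vector whose `p`-th entry is `1`. -/
abbrev FreeCoord (J : Finset ι) (p : n) : Type _ :=
  {q : ι × Sym2 n // ¬ (q.1 ∉ J ∧ p ∈ q.2)}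

/-- The parameters describing a degenerate tuple: a vector, the coefficients expressing the columns
outside `J` through those in `J`, and the free coordinates of the matrices. -/
abbrev DegenerateParam (J : Finset ι) (p : n) : Type _ :=
  (n → ℝ) × ({e // e ∉ J} × J → ℝ) × (FreeCoord J p → ℝ)

theorem card_freeCoord (J : Finset ι) (p : n) :
    Fintype.card (FreeCoord J p) + (Fintype.card ι - J.card) * Fintype.card n =
      Fintype.card (ι × Sym2 n) := by
  have hbound : (Finset.univ.filter fun q : ι × Sym2 n => q.1 ∉ J ∧ p ∈ q.2) =
      Jᶜ ×ˢ (Finset.univ.filter fun s : Sym2 n => p ∈ s) := by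
    ext q
    simp
  have hsplit := Finset.card_filter_add_card_filter_not (s := (Finset.univ : Finset (ι × Sym2 n)))
    fun q => q.1 ∉ J ∧ p ∈ q.2
  rw [hbound, Finset.card_product, card_sym2_mem, Finset.card_compl, Finset.card_univ] at hsplit
  rw [Fintype.card_subtype]
  omega

theorem finrank_degenerateParam_lt (J : Finset ι) (p : n)
    (h : Fintype.card n + (Fintype.card ι - J.card) * J.card <
      (Fintype.card ι - J.card) * Fintype.card n) :
    Module.finrank ℝ (DegenerateParam J p) < Fintype.card (ι × Sym2 n) := by
  have hfree := card_freeCoord J p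
  have hJ : Fintype.card {e // e ∉ J} = Fintype.card ι - J.card := by
    rw [Fintype.card_subtype_compl, Fintype.card_coe]
  rw [Module.finrank_prod, Module.finrank_prod, Module.finrank_fintype_fun_eq_card,
    Module.finrank_fintype_fun_eq_card, Module.finrank_fintype_fun_eq_card, Fintype.card_prod, hJ,
    Fintype.card_coe]
  omega

/-- The free coordinates, extended by zero. -/
def freeEntry (J : Finset ι) (p : n) (θ : DegenerateParam J p) (e : ι) (s : Sym2 n) : ℝ :=
  if h : ¬ (e ∉ J ∧ p ∈ s) then θ.2.2 ⟨(e, s), h⟩ else 0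

/-- The vector with `p`-th entry `1` and the other entries read off from the parameters. -/
def direction (J : Finset ι) (p : n) (θ : DegenerateParam J p) (l : n) : ℝ :=
  if l = p then 1 else θ.1 l

/-- The entry `i` of the `p`-th row of the `e`-th matrix forced by the linear relation, except that
for `i = p` the contribution of the other entries of that row is not yet subtracted. -/
def forcedEntry (b : ι → n → ℝ) (J : Finset ι) (p : n) (θ : DegenerateParam J p)
    (e : {e // e ∉ J}) (i : n) : ℝ :=
  θ.1 p * b e i
    + ∑ j : J, θ.2.1 (e, j) *
        (∑ l, freeEntry J p θ j s(i, l) * direction J p θ l - θ.1 p * b j i)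
    - ∑ l, freeEntry J p θ e s(i, l) * direction J p θ l

/-- The tuple of symmetric matrices determined by the parameters. -/
noncomputable def degenerateTuple (b : ι → n → ℝ) (J : Finset ι) (p : n)
    (θ : DegenerateParam J p) : EuclideanSpace ℝ (ι × Sym2 n) :=
  WithLp.toLp 2 fun q =>
    if h : q.1 ∉ J ∧ p ∈ q.2 then
      if Sym2.Mem.other h.2 = p then
        forcedEntry b J p θ ⟨q.1, h.1⟩ p
          - ∑ l ∈ Finset.univ.erase p, forcedEntry b J p θ ⟨q.1, h.1⟩ l * direction J p θ l
      else forcedEntry b J p θ ⟨q.1, h.1⟩ (Sym2.Mem.other h.2)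
    else freeEntry J p θ q.1 q.2

theorem contDiff_freeEntry (J : Finset ι) (p : n) (e : ι) (s : Sym2 n) :
    ContDiff ℝ 1 fun θ => freeEntry J p θ e s := by
  unfold freeEntry
  split_ifs <;> fun_prop

theorem contDiff_direction (J : Finset ι) (p l : n) :
    ContDiff ℝ 1 fun θ => direction J p θ l := by
  unfold direction
  split_ifs <;> fun_prop

theorem contDiff_forcedEntry (b : ι → n → ℝ) (J : Finset ι) (p : n) (e : {e // e ∉ J}) (i : n) :
    ContDiff ℝ 1 fun θ => forcedEntry b J p θ e i := by
  have hfree := contDiff_freeEntry J p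
  have hdir := contDiff_direction J p
  unfold forcedEntry
  fun_prop

theorem contDiff_degenerateTuple (b : ι → n → ℝ) (J : Finset ι) (p : n) :
    ContDiff ℝ 1 (degenerateTuple b J p) := by
  have hfree := contDiff_freeEntry J p
  have hdir := contDiff_direction J p
  have hforced := contDiff_forcedEntry b J p
  rw [contDiff_euclidean]
  intro q
  simp only [degenerateTuple]
  split_ifs <;> fun_prop

/-- A tuple whose columns outside `J` are linear combinations of the columns in `J`, for a vector
`x` with `x p ≠ 0`, is parametrized by `degenerateTuple`. -/
theorem mem_range_degenerateTuple (b : ι → n → ℝ) (J : Finset ι) (p : n)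
    (f : EuclideanSpace ℝ (ι × Sym2 n)) (x : n → ℝ) (hx : x p ≠ 0) (c : ι → J → ℝ)
    (hc : ∀ e i, ∑ l, f (e, s(i, l)) * x l - b e i =
      ∑ j : J, c e j * (∑ l, f (j, s(i, l)) * x l - b j i)) :
    f ∈ Set.range (degenerateTuple b J p) := by
  let θ : DegenerateParam J p :=
    (fun l => if l = p then (x p)⁻¹ else x l / x p, fun q => c q.1 q.2, fun q => f q.1)
  have hdir (l : n) : direction J p θ l = x l * (x p)⁻¹ := by
    by_cases hl : l = p
    · subst hl; simp [direction, hx]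
    · simp [direction, θ, hl, div_eq_mul_inv]
  have hfree (e : ι) (s : Sym2 n) (h : ¬ (e ∉ J ∧ p ∈ s)) : freeEntry J p θ e s = f (e, s) := by
    rw [freeEntry, dif_pos h]
  have hbound (e : ι) (s : Sym2 n) (h : e ∉ J ∧ p ∈ s) : freeEntry J p θ e s = 0 := by
    rw [freeEntry, dif_neg (not_not.2 h)]
  have hforced (e : {e // e ∉ J}) (i : n) : forcedEntry b J p θ e i =
      ∑ l, f (e, s(i, l)) * direction J p θ l
        - ∑ l, freeEntry J p θ e s(i, l) * direction J p θ l := by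
    have hJ (j : J) (l : n) : freeEntry J p θ j s(i, l) = f (j, s(i, l)) :=
      hfree _ _ fun h => h.1 j.2
    have ht : θ.1 p = (x p)⁻¹ := if_pos rfl
    rw [forcedEntry, ht]
    simp only [hJ, hdir, ← mul_assoc, ← Finset.sum_mul]
    congr 1
    rw [eq_add_of_sub_eq (hc e i), add_mul, Finset.sum_mul, add_comm, mul_comm (b _ _)]
    congr 1
    refine Finset.sum_congr rfl fun j _ => ?_
    change c e j * _ = _
    ring
  have hrow (e : {e // e ∉ J}) (i : n) (hi : i ≠ p) :
      forcedEntry b J p θ e i = f (e, s(p, i)) := by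
    rw [hforced, ← Finset.sum_sub_distrib, Finset.sum_eq_single p]
    · rw [hbound _ _ ⟨e.2, Sym2.mem_mk_right i p⟩, Sym2.eq_swap]
      simp [direction]
    · intro l _ hl
      rw [hfree, sub_self]
      rintro ⟨-, h⟩
      exact (Sym2.mem_iff.1 h).elim (fun h => hi h.symm) fun h => hl h.symm
    · simp
  refine ⟨θ, ?_⟩
  ext ⟨e, s⟩
  simp only [degenerateTuple]
  split_ifs with h ho
  · have hs : s = s(p, p) := by
      rw [← Sym2.other_spec h.2, ho]
    subst hs
    have hrest : ∑ l ∈ Finset.univ.erase p, forcedEntry b J p θ ⟨e, h.1⟩ l * direction J p θ l =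
        ∑ l ∈ Finset.univ.erase p, f (e, s(p, l)) * direction J p θ l :=
      Finset.sum_congr rfl fun l hl => by rw [hrow _ l (Finset.ne_of_mem_erase hl)]
    have hzero : ∑ l, freeEntry J p θ e s(p, l) * direction J p θ l = 0 :=
      Finset.sum_eq_zero fun l _ => by rw [hbound e _ ⟨h.1, Sym2.mem_mk_left p l⟩, zero_mul]
    rw [hrest, hforced, hzero, ← Finset.add_sum_erase _ _ (Finset.mem_univ p), sub_zero,
      add_sub_cancel_right]
    simp [direction]
  · rw [hrow _ _ ho, Sym2.other_spec h.2]
  · exact hfree e s h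

end Parametrization

/-- The codimension `(m - k) (d - k)` of the rank-`k` locus exceeds `d` for every `k ≤ d - r`. -/
theorem dim_add_lt_of_general_position_count {d m r k : ℕ} (hr : 0 < r) (hrd : r ≤ d)
    (hcount : (d : ℝ) - r + d / r < m) (hk : k ≤ d - r) :
    d + (m - k) * k < (m - k) * d := by
  have hr' : (0 : ℝ) < r := by exact_mod_cast hr
  have hkd : (k : ℝ) + r ≤ d := by exact_mod_cast (by omega : k + r ≤ d)
  have hdiv : (d : ℝ) / r * r = d := div_mul_cancel₀ _ hr'.ne'
  have hpos : (0 : ℝ) ≤ d / r := by positivity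
  have hkm : k ≤ m := by
    have : (k : ℝ) ≤ m := by linarith
    exact_mod_cast this
  have hgoal : (d : ℝ) + ((m : ℝ) - k) * k < ((m : ℝ) - k) * d := by
    have hmk : (d : ℝ) / r < m - k := by linarith
    nlinarith [mul_lt_mul_of_pos_right hmk hr',
      mul_le_mul_of_nonneg_left hkd (hpos.trans hmk.le)]
  rw [← Nat.cast_sub hkm] at hgoal
  exact_mod_cast hgoal



/-- Theorem 10 (IRM paper). The real vector space of `m`-tuples of symmetric
`d × d` matrices is coordinatized by `EuclideanSpace ℝ (Fin m × Sym2 (Fin d))`: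
a point `f` encodes the tuple of symmetric matrices `Σ^e := (f (e, s(i,j)))_{i,j}`,
and `volume` is the Lebesgue (additive Haar) measure on this space. For any
fixed tuple of vectors `b^e ∈ ℝ^d` and any degree `r` with `0 < r ≤ d` and
`m > d − r + d/r`, the set of tuples of symmetric matrices failing the linear
general position condition of degree `r` — i.e. such that for some nonzero
`x ∈ ℝ^d` the span of `{Σ^e x − b^e : e}` has dimension at most `d − r` —
has measure zero. -/
theorem general_position_fails_on_measure_zero_set
    {d m : ℕ} (hd : 1 ≤ d) (hm : 1 ≤ m)
    (r : ℕ) (hr : 0 < r) (hrd : r ≤ d)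
    (hcount : (d : ℝ) - r + d / r < m)
    (b : Fin m → Fin d → ℝ) :
    volume {f : EuclideanSpace ℝ (Fin m × Sym2 (Fin d)) |
      ∃ x : Fin d → ℝ, x ≠ 0 ∧
        Module.finrank ℝ (Submodule.span ℝ (Set.range fun e : Fin m =>
          (Matrix.of fun i j => f (e, s(i, j))).mulVec x - b e)) ≤ d - r} = 0 := by
  refine measure_mono_null (t := ⋃ (p : Fin d) (J : {J : Finset (Fin m) // J.card ≤ d - r}),
    Set.range (degenerateTuple b J.1 p)) ?_ ?_
  · rintro f ⟨x, hx, hrank⟩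
    obtain ⟨p, hp⟩ := Function.ne_iff.1 hx
    obtain ⟨J, hJ, hspan⟩ := exists_finset_card_le_finrank_span fun e : Fin m =>
      (Matrix.of fun i j => f (e, s(i, j))).mulVec x - b e
    simp only [Submodule.mem_span_image_finset_iff_exists_fun] at hspan
    choose c hc using hspan
    refine Set.mem_iUnion₂.2 ⟨p, ⟨J, hJ.trans hrank⟩, ?_⟩
    refine mem_range_degenerateTuple b J p f x hp c fun e i => ?_
    simpa [Matrix.mulVec, dotProduct] using (congrFun (hc e) i).symm
  · refine measure_iUnion_null fun p => measure_iUnion_null fun J => ?_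
    refine volume_range_eq_zero_of_finrank_lt (contDiff_degenerateTuple b J.1 p)
      (finrank_degenerateParam_lt J.1 p ?_)
    simpa using dim_add_lt_of_general_position_count hr hrd hcount J.2
end
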